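/- arXiv:2012.06105 — 2 statements merged into one kernel-verified Lean document; each statement's English description precedes it below -/
import Mathlib

section
/- Let p be an odd prime, m an even positive integer, and let f : F_{p^m} → F_{p^m} be a PN-DO function. Then the punctured code C̄_f ⊆ F_p^{p^m} has exactly p^{2m+1} codewords, minimum Hamming distance (p−1)(p^{m−1} − p^{(m−2)/2}), and weight distribution: A_0 = 1; A_{(p−1)p^{m−1}} = (p^m−1)p; A_{(p−1)p^{m−1}+(p−1)p^{(m−2)/2}} = A_{(p−1)p^{m−1}−(p−1)p^{(m−2)/2}} = (1/2)(p^m−1)p^m; A_{(p−1)p^{m−1}+p^{(m−2)/2}} = A_{(p−1)p^{m−1}−p^{(m−2)/2}} = (1/2)(p^m−1)(p−1)p^m; A_{p^m} = p−1; and A_w = 0 for all other w, where A_w is the number of codewords of Hamming weight w. -/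
noncomputable section
open scoped Classical

noncomputable instance (p n : ℕ) [Fact p.Prime] : Fintype (GaloisField p n) :=
  Fintype.ofFinite _

/-- The absolute trace map from `F_{p^m}` to `F_p`. -/
def tr (p m : ℕ) [Fact p.Prime] (x : GaloisField p m) : ZMod p :=
  Algebra.trace (ZMod p) (GaloisField p m) x

/-- The punctured codeword `(Tr(a f(x)+bx)+c)_{x∈F_{p^m}}` of length `p^m`. -/
def pWord (p m : ℕ) [Fact p.Prime] (f : GaloisField p m → GaloisField p m)
    (a b : GaloisField p m) (c : ZMod p) : GaloisField p m → ZMod p :=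
  fun x => tr p m (a * f x + b * x) + c

/-- The punctured code `C̄_f ⊆ F_p^{p^m}`. -/
def pCode (p m : ℕ) [Fact p.Prime] (f : GaloisField p m → GaloisField p m) :
    Set (GaloisField p m → ZMod p) :=
  {v | ∃ a b c, v = pWord p m f a b c}

/-- `A_w`: the number of codewords of `C̄_f` of Hamming weight `w`. -/
def pAw (p m : ℕ) [Fact p.Prime] (f : GaloisField p m → GaloisField p m) (w : ℤ) : ℕ :=
  Nat.card {v : GaloisField p m → ZMod p //
    v ∈ pCode p m f ∧ (hammingNorm v : ℤ) = w}


/-- The one-variable quadratic exponential sum. -/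
lemma aux_sum_sq (p : ℕ) [Fact p.Prime] (hp : Odd p) (d : ZMod p) (hd : d ≠ 0)
    (ψ : AddChar (ZMod p) ℂ) (hψ : ψ.IsPrimitive) :
    ∑ y : ZMod p, ψ (d * (y * y)) =
      ((quadraticChar (ZMod p) d : ℤ) : ℂ) *
        gaussSum ((quadraticChar (ZMod p)).ringHomComp (Int.castRingHom ℂ)) ψ := by
  have h2 : ringChar (ZMod p) ≠ 2 := by
    rw [ZMod.ringChar_zmod_n]; rintro rfl; exact absurd hp (by decide)
  set χ := (quadraticChar (ZMod p)).ringHomComp (Int.castRingHom ℂ) with hχ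
  have h1 : ∑ y : ZMod p, ψ (d * (y * y)) =
      ∑ z : ZMod p, (((quadraticChar (ZMod p) z + 1 : ℤ)) : ℂ) * ψ (d * z) := by
    rw [← Finset.sum_fiberwise (s := Finset.univ) (g := fun y : ZMod p => y ^ 2)]
    refine Finset.sum_congr rfl fun z _ => ?_
    rw [← quadraticChar_card_sqrts h2 z]
    rw [Finset.sum_congr rfl (g := fun _ => ψ (d * z))]
    · rw [Finset.sum_const, nsmul_eq_mul]
      congr 1
      push_cast
      congr 2
      ext; simp
    · intro y hy
      simp only [Finset.mem_filter, Finset.mem_univ, true_and] at hy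
      rw [← hy, sq]
  have h3 : ∑ z : ZMod p, ψ (d * z) = 0 := by
    have := AddChar.sum_mulShift (ψ := ψ) d hψ
    simp only [hd, if_false, Nat.cast_zero] at this
    rw [← this]; refine Finset.sum_congr rfl fun z _ => by rw [mul_comm]
  have h4 := gaussSum_mulShift χ ψ (Units.mk0 d hd)
  have h5 : gaussSum χ (ψ.mulShift d) = ∑ z : ZMod p, ((quadraticChar (ZMod p) z : ℤ) : ℂ) * ψ (d * z) := by
    simp [gaussSum, hχ, AddChar.mulShift_apply]
  rw [h1]
  simp only [Int.cast_add, Int.cast_one, add_mul, one_mul, Finset.sum_add_distrib, h3, add_zero]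
  rw [← h5, ← h4]
  have h6 : (quadraticChar (ZMod p) d : ℤ) * quadraticChar (ZMod p) d = 1 := by
    rw [← sq]; exact quadraticChar_sq_one hd
  have h7 : χ d = ((quadraticChar (ZMod p) d : ℤ) : ℂ) := by simp [hχ]
  simp only [Units.val_mk0]
  rw [← mul_assoc, h7, ← Int.cast_mul, h6]; simp

lemma aux_map_sum {A ι : Type} [AddCommMonoid A] (ψ : AddChar A ℂ) (s : Finset ι) (g : ι → A) :
    ψ (∑ i ∈ s, g i) = ∏ i ∈ s, ψ (g i) := by
  induction s using Finset.induction_on with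
  | empty => simp
  | insert i s hi ih => rw [Finset.sum_insert hi, Finset.prod_insert hi, AddChar.map_add_eq_mul, ih]

lemma aux_quad_sum (p : ℕ) [Fact p.Prime] (hp : Odd p) {V : Type} [AddCommGroup V]
    [Module (ZMod p) V] [Fintype V] (ψ : AddChar (ZMod p) ℂ) (hψ : ψ.IsPrimitive)
    (n : ℕ) (hn : Module.finrank (ZMod p) V = 2 * n)
    (Q : QuadraticForm (ZMod p) V)
    (hQ : ∀ x, (∀ y, Q (x + y) - Q x - Q y = 0) → x = 0) :
    ∃ e : ℤ, (e = 1 ∨ e = -1) ∧ ∀ t : ZMod p, t ≠ 0 →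
      ∑ x : V, ψ (t * Q x) = (e : ℂ) * (p : ℂ) ^ n := by
  have hr : ringChar (ZMod p) ≠ 2 := by
    rw [ZMod.ringChar_zmod_n]; rintro rfl; exact absurd hp (by decide)
  have h2 : (2 : ZMod p) ≠ 0 := Ring.two_ne_zero hr
  have : Invertible (2 : ZMod p) := invertibleOfNonzero h2
  have : FiniteDimensional (ZMod p) V := Module.Finite.of_finite
  obtain ⟨w, ⟨E⟩⟩ := QuadraticForm.equivalent_weightedSumSquares_units_of_nondegenerate' Q (by
    intro x hx
    refine hQ x fun y => ?_
    have := hx y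
    rw [QuadraticMap.associated_apply] at this
    have h := congrArg (fun z => (2 : Module.End (ZMod p) (ZMod p)) • z) this
    simpa only [smul_smul, mul_invOf_self, one_smul, smul_zero] using h)
  set χ := (quadraticChar (ZMod p)).ringHomComp (Int.castRingHom ℂ) with hχ
  have hsq : gaussSum χ ψ ^ 2 = χ (-1) * (Fintype.card (ZMod p) : ℂ) :=
    gaussSum_sq ((MulChar.ringHomComp_ne_one_iff (Int.cast_injective)).2 (quadraticChar_ne_one hr))
      ((quadraticChar_isQuadratic _).comp _) hψ
  rw [ZMod.card] at hsq
  have hpm : ∀ d : ZMod p, d ≠ 0 → quadraticChar (ZMod p) d = 1 ∨ quadraticChar (ZMod p) d = -1 :=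
    fun d hd => quadraticChar_dichotomy hd
  have hsq1 : ∀ d : ZMod p, d ≠ 0 → quadraticChar (ZMod p) d ^ 2 = 1 :=
    fun d hd => quadraticChar_sq_one hd
  refine ⟨quadraticChar (ZMod p) (-1) ^ n * ∏ i, quadraticChar (ZMod p) (w i), ?_, ?_⟩
  · rw [← sq_eq_one_iff, mul_pow, ← pow_mul, mul_comm n, pow_mul, hsq1 _ (by simp), one_pow, one_mul,
      ← Finset.prod_pow]
    exact Finset.prod_eq_one fun i _ => hsq1 _ (w i).ne_zero
  · intro t ht
    have e1 : ∑ x : V, ψ (t * Q x) =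
        ∑ v : Fin (Module.finrank (ZMod p) V) → ZMod p, ∏ i, ψ ((t * w i) * (v i * v i)) := by
      refine Fintype.sum_equiv E.toLinearEquiv.toEquiv _ _ fun x => ?_
      have : Q x = QuadraticMap.weightedSumSquares (ZMod p) w (E x) := (E.map_app x).symm
      rw [this, QuadraticMap.weightedSumSquares_apply, Finset.mul_sum, aux_map_sum]
      refine Finset.prod_congr rfl fun i _ => ?_
      simp only [Units.smul_def, smul_eq_mul, mul_assoc]
      rfl
    have e0 : gaussSum χ ψ ^ Module.finrank (ZMod p) V = (χ (-1) * (p : ℂ)) ^ n := by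
      rw [hn, pow_mul, hsq]
    have e2 := Finset.prod_univ_sum (fun _ : Fin (Module.finrank (ZMod p) V) => (Finset.univ : Finset (ZMod p)))
      (fun i y => ψ ((t * w i) * (y * y)))
    rw [Fintype.piFinset_univ] at e2
    rw [e1, ← e2]
    rw [Finset.prod_congr rfl fun i _ => aux_sum_sq p hp (t * w i) (mul_ne_zero ht (w i).ne_zero) ψ hψ]
    rw [Finset.prod_mul_distrib, Finset.prod_const, Finset.card_univ, Fintype.card_fin, ← hχ, e0]
    simp only [map_mul, Int.cast_mul, Finset.prod_mul_distrib, Finset.prod_const, Finset.card_univ, Fintype.card_fin]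
    have e3 : ((quadraticChar (ZMod p) t : ℤ) : ℂ) ^ Module.finrank (ZMod p) V = 1 := by
      rw [hn, pow_mul, ← Int.cast_pow, hsq1 t ht]; simp
    rw [e3]
    have e4 : χ (-1) = ((quadraticChar (ZMod p) (-1) : ℤ) : ℂ) := by simp [hχ]
    rw [e4]
    push_cast
    ring

lemma aux_tr_sum (p m : ℕ) [Fact p.Prime] (hm0 : 0 < m)
    (ψ : AddChar (ZMod p) ℂ) (hψ : ψ.IsPrimitive) (y : GaloisField p m) :
    ∑ a : GaloisField p m, ψ (tr p m (a * y)) = if y = 0 then (p : ℂ) ^ m else 0 := by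
  have hc : Fintype.card (GaloisField p m) = p ^ m := by
    rw [← Nat.card_eq_fintype_card, GaloisField.card p m hm0.ne']
  split_ifs with h
  · simp [h, tr, hc]
  · let φ : GaloisField p m →+ ZMod p :=
      (Algebra.trace (ZMod p) (GaloisField p m)).toAddMonoidHom.comp (AddMonoidHom.mulRight y)
    have := AddChar.sum_eq_zero_of_ne_one (ψ := ψ.compAddMonoidHom φ) (by
      intro h1
      obtain ⟨u, hu⟩ : ∃ u, ψ u ≠ 1 := by
        have := hψ (a := 1) one_ne_zero
        by_contra! hcon
        exact this (by ext x; simp [hcon])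
      obtain ⟨x, hx⟩ := Algebra.trace_surjective (ZMod p) (GaloisField p m) u
      apply hu
      have := DFunLike.congr_fun h1 (x * y⁻¹)
      simpa [φ, h, hx] using this)
    simpa [φ, tr] using this

/-- Counting zeros with characters. -/
lemma aux_zeros (p : ℕ) [Fact p.Prime] {V : Type} [Fintype V] (ψ : AddChar (ZMod p) ℂ)
    (hψ : ψ.IsPrimitive) (g : V → ZMod p) :
    (p : ℂ) * ((Fintype.card V : ℂ) - (hammingNorm g : ℂ)) =
      (Fintype.card V : ℂ) + ∑ t ∈ Finset.univ.erase (0 : ZMod p), ∑ x : V, ψ (t * g x) := by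
  have h0 : (Fintype.card V : ℂ) = ∑ x : V, ψ (0 * g x) := by simp
  have h1 : (Fintype.card V : ℂ) + ∑ t ∈ Finset.univ.erase (0 : ZMod p), ∑ x : V, ψ (t * g x)
      = ∑ t : ZMod p, ∑ x : V, ψ (t * g x) := by
    rw [← Finset.add_sum_erase _ _ (Finset.mem_univ (0 : ZMod p)), ← h0]
  rw [h1, Finset.sum_comm]
  simp only [AddChar.sum_mulShift _ hψ, ZMod.card]
  have h2 : Fintype.card V = hammingNorm g + (Finset.univ.filter fun x => g x = 0).card := by
    rw [hammingNorm, add_comm, Finset.card_filter_add_card_filter_not, Finset.card_univ]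
  rw [h2]
  simp only [Nat.cast_ite, Nat.cast_zero, ← Finset.sum_filter, Finset.sum_const, nsmul_eq_mul]
  push_cast
  ring

lemma aux_tr_smul (p m : ℕ) [Fact p.Prime] (t : ZMod p) (x : GaloisField p m) :
    tr p m (algebraMap (ZMod p) (GaloisField p m) t * x) = t * tr p m x := by
  rw [tr, ← Algebra.smul_def, map_smul, smul_eq_mul, tr]

lemma aux_tr_add (p m : ℕ) [Fact p.Prime] (x y : GaloisField p m) :
    tr p m (x + y) = tr p m x + tr p m y := by simp [tr]

/-- The quadratic form `x ↦ Tr(a f(x))`. -/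
lemma aux_form (p m : ℕ) [Fact p.Prime]
    (f : GaloisField p m → GaloisField p m) (δ : Fin m → Fin m → GaloisField p m)
    (hDO : ∀ x, f x = ∑ i : Fin m, ∑ j : Fin m, δ i j * x ^ (p ^ (i : ℕ) + p ^ (j : ℕ)))
    (a : GaloisField p m) :
    ∃ Q : QuadraticForm (ZMod p) (GaloisField p m), ∀ x, Q x = tr p m (a * f x) := by
  have hsm : ∀ (t : ZMod p) (x : GaloisField p m) (i : ℕ), (t • x) ^ p ^ i = t • x ^ p ^ i := by
    intro t x i
    rw [smul_pow, ZMod.pow_card_pow]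
  let B : GaloisField p m →ₗ[ZMod p] GaloisField p m →ₗ[ZMod p] ZMod p :=
    LinearMap.mk₂ (ZMod p)
      (fun x y => Algebra.trace (ZMod p) (GaloisField p m)
        (a * ∑ i : Fin m, ∑ j : Fin m, δ i j * (x ^ p ^ (i : ℕ) * y ^ p ^ (j : ℕ))))
      (by
        intro x x' y
        rw [← map_add, ← mul_add, ← Finset.sum_add_distrib]
        simp only [← Finset.sum_add_distrib, add_pow_char_pow, add_mul, mul_add])
      (by
        intro t x y
        rw [← map_smul, ← mul_smul_comm, Finset.smul_sum]
        simp only [Finset.smul_sum, hsm, smul_mul_assoc, mul_smul_comm])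
      (by
        intro x y y'
        rw [← map_add, ← mul_add, ← Finset.sum_add_distrib]
        simp only [← Finset.sum_add_distrib, add_pow_char_pow, mul_add])
      (by
        intro t x y
        rw [← map_smul, ← mul_smul_comm, Finset.smul_sum]
        simp only [Finset.smul_sum, hsm, mul_smul_comm])
  refine ⟨LinearMap.BilinMap.toQuadraticMap B, fun x => ?_⟩
  rw [LinearMap.BilinMap.toQuadraticMap_apply, LinearMap.mk₂_apply, hDO, tr]
  simp only [pow_add]

lemma aux_main (p m : ℕ) [Fact p.Prime] (hp : Odd p) (n : ℕ) (hm : m = 2 * (n + 1))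
    (f : GaloisField p m → GaloisField p m)
    (hPN : ∀ a : GaloisField p m, a ≠ 0 → ∀ b : GaloisField p m,
      ∃! x : GaloisField p m, f (x + a) - f x = b)
    (δ : Fin m → Fin m → GaloisField p m)
    (hDO : ∀ x, f x = ∑ i : Fin m, ∑ j : Fin m, δ i j * x ^ (p ^ (i : ℕ) + p ^ (j : ℕ))) :
    ∃ (e : GaloisField p m → ℤ) (k : GaloisField p m → GaloisField p m → ZMod p),
      (∀ a, a ≠ 0 → e a = 1 ∨ e a = -1) ∧
      (∑ a ∈ Finset.univ.erase (0 : GaloisField p m), e a = 0) ∧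
      (∀ a, a ≠ 0 → ∀ b c, (hammingNorm (pWord p m f a b c) : ℤ) =
        if c = k a b then ((p : ℤ) - 1) * (p : ℤ) ^ (2 * n + 1) - e a * (((p : ℤ) - 1) * (p : ℤ) ^ n)
        else ((p : ℤ) - 1) * (p : ℤ) ^ (2 * n + 1) + e a * (p : ℤ) ^ n) ∧
      (∀ b, b ≠ 0 → ∀ c, (hammingNorm (pWord p m f 0 b c) : ℤ) =
        ((p : ℤ) - 1) * (p : ℤ) ^ (2 * n + 1)) := by
  have hm0 : 0 < m := by omega
  have hp0 : p ≠ 0 := (Fact.out : p.Prime).ne_zero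
  have hp0C : (p : ℂ) ≠ 0 := by exact_mod_cast hp0
  have hr : ringChar (ZMod p) ≠ 2 := by
    rw [ZMod.ringChar_zmod_n]; rintro rfl; exact absurd hp (by decide)
  have h2 : (2 : ZMod p) ≠ 0 := Ring.two_ne_zero hr
  have hc : Fintype.card (GaloisField p m) = p ^ m := by
    rw [← Nat.card_eq_fintype_card, GaloisField.card p m hm0.ne']
  have hc' : Fintype.card (GaloisField p m) = p ^ (2 * (n + 1)) := by rw [hc, hm]
  have hfr : Module.finrank (ZMod p) (GaloisField p m) = 2 * (n + 1) := by
    rw [GaloisField.finrank p hm0.ne', hm]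
  obtain ⟨ψ, hψ⟩ : ∃ ψ : AddChar (ZMod p) ℂ, ψ.IsPrimitive :=
    ⟨_, ZMod.isPrimitive_stdAddChar p⟩
  choose Q hQ using aux_form p m f δ hDO
  -- polarization is nondegenerate
  have hnd : ∀ a, a ≠ 0 → ∀ x, (∀ y, Q a (x + y) - Q a x - Q a y = 0) → x = 0 := by
    intro a ha x hx
    by_contra hx0
    obtain ⟨z, hz⟩ := Algebra.trace_surjective (ZMod p) (GaloisField p m) 1
    obtain ⟨y, hy, -⟩ := hPN x hx0 (a⁻¹ * z + f x)
    have := hx y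
    rw [hQ, hQ, hQ, add_comm x y] at this
    have h3 : f (y + x) = f y + a⁻¹ * z + f x := by
      linear_combination hy
    have h4 : a * f (y + x) = a * f y + z + a * f x := by
      rw [h3]; field_simp
    rw [h4, aux_tr_add, aux_tr_add] at this
    have h5 : tr p m z = 1 := hz
    rw [h5] at this
    have : (1 : ZMod p) = 0 := by linear_combination this
    exact one_ne_zero this
  have hf0 : ∀ x, f x = 0 ↔ x = 0 := by
    intro x
    constructor
    · intro h
      refine hnd 1 one_ne_zero x fun y => ?_
      by_contra hcon
      -- f x = 0 gives f (0 + x) - f 0 = 0 and f(-x + x) - f(-x) = 0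
      have hz : f 0 = 0 := by rw [hDO]; simp [hp0]
      have hneg : ∀ z, f (-z) = f z := by
        intro z
        rw [hDO, hDO]
        refine Finset.sum_congr rfl fun i _ => Finset.sum_congr rfl fun j _ => ?_
        rw [Even.neg_pow]
        exact (hp.pow).add_odd (hp.pow)
      by_cases hx : x = 0
      · subst hx
        apply hcon
        simp
      · have := (hPN x hx 0).unique (y₁ := 0) (y₂ := -x) (by simp [h, hz]) (by simp [hneg, h, hz])
        exact hx (by simpa using this.symm)
    · rintro rfl; rw [hDO]; simp [hp0]
  have hE : ∀ a : GaloisField p m, ∃ e : ℤ, a ≠ 0 → ((e = 1 ∨ e = -1) ∧ ∀ t : ZMod p, t ≠ 0 →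
      ∑ x : GaloisField p m, ψ (t * Q a x) = (e : ℂ) * (p : ℂ) ^ (n + 1)) := by
    intro a
    by_cases ha : a = 0
    · exact ⟨0, fun h => absurd ha h⟩
    · obtain ⟨e, he⟩ := aux_quad_sum p hp ψ hψ (n + 1) hfr (Q a) (hnd a ha)
      exact ⟨e, fun _ => he⟩
  choose e he using hE
  -- completing the square
  have hU : ∀ a b : GaloisField p m, ∃ u, a ≠ 0 → ∀ x, Q a (x + u) = Q a x + tr p m (b * x) + Q a u := by
    intro a b
    by_cases ha : a = 0
    · exact ⟨0, fun h => absurd ha h⟩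
    · let P := QuadraticMap.polarBilin (Q a)
      have hinj : Function.Injective P := by
        rw [injective_iff_map_eq_zero]
        intro x hx
        refine hnd a ha x fun y => ?_
        have := LinearMap.congr_fun hx y
        simpa [P, QuadraticMap.polar] using this
      have hs := (LinearMap.injective_iff_surjective_of_finrank_eq_finrank
        (by exact (Subspace.dual_finrank_eq (K := ZMod p) (V := GaloisField p m)).symm)).1 hinj
      obtain ⟨u, hu⟩ := hs ((Algebra.trace (ZMod p) (GaloisField p m)).comp (LinearMap.mulLeft (ZMod p) b))
      refine ⟨u, fun _ x => ?_⟩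
      have := LinearMap.congr_fun hu x
      simp only [P, QuadraticMap.polarBilin_apply_apply, QuadraticMap.polar, LinearMap.comp_apply,
        LinearMap.mulLeft_apply] at this
      rw [tr, ← this, add_comm u x]
      ring
  choose u hu using hU
  refine ⟨e, fun a b => Q a (u a b), fun a ha => (he a ha).1, ?_, ?_, ?_⟩
  · have h1 : ∑ a : GaloisField p m, ∑ x : GaloisField p m, ψ (tr p m (a * f x)) = (p : ℂ) ^ m := by
      rw [Finset.sum_comm]
      simp only [aux_tr_sum p m hm0 ψ hψ, hf0]
      simp
    rw [← Finset.add_sum_erase _ _ (Finset.mem_univ (0 : GaloisField p m))] at h1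
    have h3 : ∑ x : GaloisField p m, ψ (tr p m (0 * f x)) = (p : ℂ) ^ m := by
      simp [tr, hc]
    rw [h3] at h1
    have h4 : ∀ a ∈ Finset.univ.erase (0 : GaloisField p m),
        ∑ x : GaloisField p m, ψ (tr p m (a * f x)) = (e a : ℂ) * (p : ℂ) ^ (n + 1) := by
      intro a ha
      rw [← (he a (Finset.ne_of_mem_erase ha)).2 1 one_ne_zero]
      simp only [hQ, one_mul]
    rw [Finset.sum_congr rfl h4, ← Finset.sum_mul] at h1
    have h5 : (∑ a ∈ Finset.univ.erase (0 : GaloisField p m), (e a : ℂ)) * (p : ℂ) ^ (n + 1) = 0 := by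
      linear_combination h1
    have h6 := (mul_eq_zero.1 h5).resolve_right (pow_ne_zero _ hp0C)
    exact_mod_cast h6
  · intro a ha b c
    have h1 := aux_zeros p ψ hψ (pWord p m f a b c)
    have h3 : ∀ t ∈ Finset.univ.erase (0 : ZMod p),
        ∑ x : GaloisField p m, ψ (t * pWord p m f a b c x) =
          ψ (t * (c - Q a (u a b))) * ((e a : ℂ) * (p : ℂ) ^ (n + 1)) := by
      intro t ht
      rw [← (he a ha).2 t (Finset.ne_of_mem_erase ht), Finset.mul_sum]
      refine Fintype.sum_equiv (Equiv.addRight (u a b)) _ _ fun x => ?_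
      rw [← AddChar.map_add_eq_mul]
      congr 1
      simp only [Equiv.coe_addRight, hu a b ha x, pWord, aux_tr_add, hQ]
      ring
    rw [Finset.sum_congr rfl h3, ← Finset.sum_mul] at h1
    have h4 : ∑ t ∈ Finset.univ.erase (0 : ZMod p), ψ (t * (c - Q a (u a b))) =
        (if c = Q a (u a b) then (p : ℂ) else 0) - 1 := by
      have := AddChar.sum_mulShift (ψ := ψ) (c - Q a (u a b)) hψ
      rw [← Finset.add_sum_erase _ _ (Finset.mem_univ (0 : ZMod p))] at this
      simp only [zero_mul, AddChar.map_zero_eq_one, sub_eq_zero, ZMod.card, Nat.cast_ite, Nat.cast_zero] at this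
      rw [← this]; ring
    rw [h4, hc'] at h1
    have h5 : (hammingNorm (pWord p m f a b c) : ℂ) =
        if c = Q a (u a b) then ((p : ℂ) - 1) * (p : ℂ) ^ (2 * n + 1) - e a * (((p : ℂ) - 1) * (p : ℂ) ^ n)
        else ((p : ℂ) - 1) * (p : ℂ) ^ (2 * n + 1) + e a * (p : ℂ) ^ n := by
      apply mul_left_cancel₀ hp0C
      push_cast at h1
      split_ifs at h1 ⊢
      · linear_combination -h1
      · linear_combination -h1
    split_ifs at h5 ⊢
    · exact_mod_cast h5
    · exact_mod_cast h5
  · intro b hb c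
    have h1 := aux_zeros p ψ hψ (pWord p m f 0 b c)
    have h3 : ∀ t ∈ Finset.univ.erase (0 : ZMod p),
        ∑ x : GaloisField p m, ψ (t * pWord p m f 0 b c x) = 0 := by
      intro t ht
      have ht := Finset.ne_of_mem_erase ht
      have h4 := aux_tr_sum p m hm0 ψ hψ (algebraMap (ZMod p) (GaloisField p m) t * b)
      rw [if_neg (mul_ne_zero (by simpa using ht) hb)] at h4
      have h5 : ∀ x : GaloisField p m, ψ (t * pWord p m f 0 b c x) =
          ψ (tr p m (x * (algebraMap (ZMod p) (GaloisField p m) t * b))) * ψ (t * c) := by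
        intro x
        rw [← AddChar.map_add_eq_mul, mul_left_comm, aux_tr_smul, pWord, mul_comm x b]
        simp only [zero_mul, zero_add]
        rw [mul_add]
      simp only [h5]
      rw [← Finset.sum_mul, h4, zero_mul]
    rw [Finset.sum_congr rfl h3, hc'] at h1
    have h5 : (hammingNorm (pWord p m f 0 b c) : ℂ) = ((p : ℂ) - 1) * (p : ℂ) ^ (2 * n + 1) := by
      apply mul_left_cancel₀ hp0C
      push_cast at h1
      simp only [Finset.sum_const_zero] at h1
      linear_combination -h1
    exact_mod_cast h5

lemma aux_zero_word (p m : ℕ) [Fact p.Prime] (hm0 : 0 < m)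
    (f : GaloisField p m → GaloisField p m) (c : ZMod p) :
    (hammingNorm (pWord p m f 0 0 c) : ℤ) = if c = 0 then 0 else (p : ℤ) ^ m := by
  have hc : Fintype.card (GaloisField p m) = p ^ m := by
    rw [← Nat.card_eq_fintype_card, GaloisField.card p m hm0.ne']
  have hw : pWord p m f 0 0 c = fun _ => c := by
    funext x; simp [pWord, tr]
  rw [hw]
  split_ifs with h
  · subst h; simp [hammingNorm]
  · simp [hammingNorm, h, hc]

lemma aux_sub (p m : ℕ) [Fact p.Prime] (f : GaloisField p m → GaloisField p m)
    (a b a' b' : GaloisField p m) (c c' : ZMod p) :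
    pWord p m f (a - a') (b - b') (c - c') = pWord p m f a b c - pWord p m f a' b' c' := by
  funext x
  have : (a - a') * f x + (b - b') * x = (a * f x + b * x) - (a' * f x + b' * x) := by ring
  simp only [pWord, Pi.sub_apply, this, tr, map_sub]
  ring

lemma aux_combi (p m : ℕ) [Fact p.Prime] (hm0 : 0 < m)
    (f : GaloisField p m → GaloisField p m) (M D P : ℤ)
    (e : GaloisField p m → ℤ) (k : GaloisField p m → GaloisField p m → ZMod p)
    (he : ∀ a, a ≠ 0 → e a = 1 ∨ e a = -1)
    (hs : ∑ a ∈ Finset.univ.erase (0 : GaloisField p m), e a = 0)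
    (h1 : ∀ a, a ≠ 0 → ∀ b c, (hammingNorm (pWord p m f a b c) : ℤ) =
        if c = k a b then M - e a * D else M + e a * P)
    (h2 : ∀ b, b ≠ 0 → ∀ c, (hammingNorm (pWord p m f 0 b c) : ℤ) = M)
    (hinj : Function.Injective
      (fun t : GaloisField p m × GaloisField p m × ZMod p => pWord p m f t.1 t.2.1 t.2.2))
    (w : ℤ) :
    2 * pAw p m f w = 2 * ((if 0 = w then 1 else 0) + (p - 1) * (if (p : ℤ) ^ m = w then 1 else 0))
      + 2 * ((p ^ m - 1) * p * (if M = w then 1 else 0))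
      + (p ^ m - 1) * p ^ m * ((if M - D = w then 1 else 0) + (if M + D = w then 1 else 0))
      + (p ^ m - 1) * (p - 1) * p ^ m * ((if M + P = w then 1 else 0) + (if M - P = w then 1 else 0)) := by
  have hc : Fintype.card (GaloisField p m) = p ^ m := by
    rw [← Nat.card_eq_fintype_card, GaloisField.card p m hm0.ne']
  have hcc : ∀ (k : ZMod p) (x y : ℤ),
      ∑ c : ZMod p, (if (if c = k then x else y) = w then 1 else 0 : ℕ) =
        (if x = w then 1 else 0) + (p - 1) * (if y = w then 1 else 0) := by
    intro k x y
    rw [← Finset.add_sum_erase _ _ (Finset.mem_univ k)]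
    rw [Finset.sum_congr rfl (g := fun _ => (if y = w then 1 else 0 : ℕ))]
    · rw [Finset.sum_const, Finset.card_erase_of_mem (Finset.mem_univ _), Finset.card_univ, ZMod.card]
      simp
    · intro c hc
      rw [if_neg (Finset.ne_of_mem_erase hc)]
  have hA : pAw p m f w = ∑ a : GaloisField p m, ∑ b : GaloisField p m, ∑ c : ZMod p,
      (if (hammingNorm (pWord p m f a b c) : ℤ) = w then 1 else 0 : ℕ) := by
    rw [pAw]
    have : Nat.card {v : GaloisField p m → ZMod p // v ∈ pCode p m f ∧ (hammingNorm v : ℤ) = w} =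
        Nat.card {t : GaloisField p m × GaloisField p m × ZMod p //
          (hammingNorm (pWord p m f t.1 t.2.1 t.2.2) : ℤ) = w} := by
      symm
      refine Nat.card_congr (Equiv.ofBijective
        (fun t => ⟨pWord p m f t.1.1 t.1.2.1 t.1.2.2, ⟨_, _, _, rfl⟩, t.2⟩) ⟨?_, ?_⟩)
      · intro t t' h
        apply Subtype.ext
        apply hinj
        exact congrArg Subtype.val h
      · rintro ⟨v, ⟨a, b, c, rfl⟩, hv⟩
        exact ⟨⟨(a, b, c), hv⟩, rfl⟩
    rw [this, Nat.card_eq_fintype_card, Fintype.card_subtype, Finset.card_filter,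
      Fintype.sum_prod_type]
    refine Finset.sum_congr rfl fun a _ => ?_
    rw [Fintype.sum_prod_type]
  let g : ℤ → ℕ := fun ε => (if M - ε * D = w then 1 else 0) + (p - 1) * (if M + ε * P = w then 1 else 0)
  have hA1 : ∀ a ∈ Finset.univ.erase (0 : GaloisField p m), ∑ b : GaloisField p m, ∑ c : ZMod p,
      (if (hammingNorm (pWord p m f a b c) : ℤ) = w then 1 else 0 : ℕ) = p ^ m * g (e a) := by
    intro a ha
    simp only [h1 a (Finset.ne_of_mem_erase ha), hcc]
    rw [Finset.sum_const, Finset.card_univ, hc, smul_eq_mul]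
  have hA0 : ∑ b : GaloisField p m, ∑ c : ZMod p,
      (if (hammingNorm (pWord p m f 0 b c) : ℤ) = w then 1 else 0 : ℕ) =
      (if 0 = w then 1 else 0) + (p - 1) * (if (p : ℤ) ^ m = w then 1 else 0)
      + (p ^ m - 1) * p * (if M = w then 1 else 0) := by
    rw [← Finset.add_sum_erase _ _ (Finset.mem_univ (0 : GaloisField p m))]
    simp only [aux_zero_word p m hm0 f, hcc]
    congr 1
    rw [Finset.sum_congr rfl (g := fun _ => p * (if M = w then 1 else 0 : ℕ))]
    · rw [Finset.sum_const, Finset.card_erase_of_mem (Finset.mem_univ _), Finset.card_univ, hc,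
        smul_eq_mul, mul_assoc]
    · intro b hb
      simp only [h2 b (Finset.ne_of_mem_erase hb)]
      rw [Finset.sum_const, Finset.card_univ, ZMod.card, smul_eq_mul]
  have hg : 2 * ∑ a ∈ Finset.univ.erase (0 : GaloisField p m), g (e a) = (p ^ m - 1) * (g 1 + g (-1)) := by
    have hz : ((2 * ∑ a ∈ Finset.univ.erase (0 : GaloisField p m), g (e a) : ℕ) : ℤ) =
        (((p ^ m - 1) * (g 1 + g (-1)) : ℕ) : ℤ) := by
      rw [Nat.cast_mul, Nat.cast_sum, Finset.mul_sum]
      rw [Finset.sum_congr rfl (g := fun a => ((g 1 : ℤ) + g (-1)) + e a * ((g 1 : ℤ) - g (-1)))]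
      · rw [Finset.sum_add_distrib, ← Finset.sum_mul, hs, Finset.sum_const,
          Finset.card_erase_of_mem (Finset.mem_univ _), Finset.card_univ, hc]
        rw [nsmul_eq_mul]
        push_cast
        ring
      · intro a ha
        rcases he a (Finset.ne_of_mem_erase ha) with h | h <;> rw [h] <;> push_cast <;> ring
    exact_mod_cast hz
  rw [hA, ← Finset.add_sum_erase _ _ (Finset.mem_univ (0 : GaloisField p m)), hA0,
    Finset.sum_congr rfl hA1, ← Finset.mul_sum, mul_add, mul_left_comm 2 (p ^ m), hg]
  simp only [g, one_mul, neg_mul, sub_neg_eq_add, ← sub_eq_add_neg]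
  ring

/-- For `p` an odd prime, `m` even, `f` a PN-DO function on `F_{p^m}`,
the punctured code `C̄_f` has `p^{2m+1}` codewords, minimum Hamming distance
`(p−1)(p^{m−1} − p^{(m−2)/2})`, and the stated weight distribution. -/
theorem stmt_9 (p m : ℕ) [Fact p.Prime] (hp : Odd p) (hm : Even m) (hm0 : 0 < m)
    (f : GaloisField p m → GaloisField p m)
    (hPN : ∀ a : GaloisField p m, a ≠ 0 → ∀ b : GaloisField p m,
      ∃! x : GaloisField p m, f (x + a) - f x = b)
    (δ : Fin m → Fin m → GaloisField p m)
    (hDO : ∀ x, f x = ∑ i : Fin m, ∑ j : Fin m, δ i j * x ^ (p ^ (i : ℕ) + p ^ (j : ℕ))) :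
    Set.ncard (pCode p m f) = p ^ (2 * m + 1) ∧
    (∀ v ∈ pCode p m f, v ≠ 0 →
      ((p : ℤ) - 1) * ((p : ℤ) ^ (m - 1) - (p : ℤ) ^ ((m - 2) / 2))
        ≤ (hammingNorm v : ℤ)) ∧
    (∃ v ∈ pCode p m f, v ≠ 0 ∧ (hammingNorm v : ℤ)
        = ((p : ℤ) - 1) * ((p : ℤ) ^ (m - 1) - (p : ℤ) ^ ((m - 2) / 2))) ∧
    pAw p m f 0 = 1 ∧
    pAw p m f (((p : ℤ) - 1) * (p : ℤ) ^ (m - 1)) = (p ^ m - 1) * p ∧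
    2 * pAw p m f (((p : ℤ) - 1) * (p : ℤ) ^ (m - 1)
        + ((p : ℤ) - 1) * (p : ℤ) ^ ((m - 2) / 2)) = (p ^ m - 1) * p ^ m ∧
    2 * pAw p m f (((p : ℤ) - 1) * (p : ℤ) ^ (m - 1)
        - ((p : ℤ) - 1) * (p : ℤ) ^ ((m - 2) / 2)) = (p ^ m - 1) * p ^ m ∧
    2 * pAw p m f (((p : ℤ) - 1) * (p : ℤ) ^ (m - 1) + (p : ℤ) ^ ((m - 2) / 2))
      = (p ^ m - 1) * (p - 1) * p ^ m ∧
    2 * pAw p m f (((p : ℤ) - 1) * (p : ℤ) ^ (m - 1) - (p : ℤ) ^ ((m - 2) / 2))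
      = (p ^ m - 1) * (p - 1) * p ^ m ∧
    pAw p m f ((p : ℤ) ^ m) = p - 1 ∧
    (∀ w : ℤ, w ∉ ({0,
        ((p : ℤ) - 1) * (p : ℤ) ^ (m - 1),
        ((p : ℤ) - 1) * (p : ℤ) ^ (m - 1) + ((p : ℤ) - 1) * (p : ℤ) ^ ((m - 2) / 2),
        ((p : ℤ) - 1) * (p : ℤ) ^ (m - 1) - ((p : ℤ) - 1) * (p : ℤ) ^ ((m - 2) / 2),
        ((p : ℤ) - 1) * (p : ℤ) ^ (m - 1) + (p : ℤ) ^ ((m - 2) / 2),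
        ((p : ℤ) - 1) * (p : ℤ) ^ (m - 1) - (p : ℤ) ^ ((m - 2) / 2),
        (p : ℤ) ^ m} : Set ℤ) →
      pAw p m f w = 0) := by
  obtain ⟨n, hn⟩ : ∃ n, m = 2 * (n + 1) := by
    obtain ⟨r, hr⟩ := hm
    exact ⟨r - 1, by omega⟩
  obtain ⟨e, k, he, hs, h1, h2⟩ := aux_main p m hp n hn f hPN δ hDO
  have hpp : p.Prime := Fact.out
  have hp3 : 3 ≤ p := by
    have := hpp.two_le
    rcases hp with ⟨r, hr⟩
    omega
  have hp3' : (3 : ℤ) ≤ p := by exact_mod_cast hp3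
  have em1 : m - 1 = 2 * n + 1 := by omega
  have em2 : (m - 2) / 2 = n := by omega
  have hpm : (p : ℤ) ^ m = (p : ℤ) ^ (2 * n + 1) * p := by rw [hn]; ring
  have hc : Fintype.card (GaloisField p m) = p ^ m := by
    rw [← Nat.card_eq_fintype_card, GaloisField.card p m hm0.ne']
  rw [em1, em2]
  have hz := aux_zero_word p m hm0 f
  -- numerical facts
  have hPpos : (0 : ℤ) < (p : ℤ) ^ n := by positivity
  have hR : (p : ℤ) ^ n * p ≤ (p : ℤ) ^ (2 * n + 1) := by
    rw [← pow_succ]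
    exact pow_le_pow_right₀ (by linarith) (by omega)
  have hDdef : ((p : ℤ) - 1) * (p : ℤ) ^ n = (p : ℤ) ^ n * p - (p : ℤ) ^ n := by ring
  have hMdef : ((p : ℤ) - 1) * (p : ℤ) ^ (2 * n + 1) = (p : ℤ) ^ m - (p : ℤ) ^ (2 * n + 1) := by
    rw [hpm]; ring
  have hD2 : 2 * (p : ℤ) ^ n ≤ ((p : ℤ) - 1) * (p : ℤ) ^ n := by nlinarith
  have hM2 : 2 * (p : ℤ) ^ (2 * n + 1) ≤ ((p : ℤ) - 1) * (p : ℤ) ^ (2 * n + 1) := by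
    have : (0 : ℤ) < (p : ℤ) ^ (2 * n + 1) := by positivity
    nlinarith
  rw [mul_sub]
  generalize hP : (p : ℤ) ^ n = P at *
  generalize hRR : (p : ℤ) ^ (2 * n + 1) = R at *
  generalize hMM : ((p : ℤ) - 1) * R = M at *
  generalize hDD : ((p : ℤ) - 1) * P = D at *
  have hinj : Function.Injective
      (fun t : GaloisField p m × GaloisField p m × ZMod p => pWord p m f t.1 t.2.1 t.2.2) := by
    rintro ⟨a, b, c⟩ ⟨a', b', c'⟩ h
    have h3 := aux_sub p m f a b a' b' c c'
    simp only at h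
    rw [h, sub_self] at h3
    have h4 : (hammingNorm (pWord p m f (a - a') (b - b') (c - c')) : ℤ) = 0 := by
      rw [h3]; simp
    have ha : a - a' = 0 := by
      by_contra ha
      rw [h1 _ ha] at h4
      rcases he _ ha with h5 | h5 <;> rw [h5] at h4 <;> split_ifs at h4 <;> omega
    rw [ha] at h4
    have hb : b - b' = 0 := by
      by_contra hb
      rw [h2 _ hb] at h4
      omega
    rw [hb, hz] at h4
    have hc : c - c' = 0 := by
      by_contra hc
      rw [if_neg hc] at h4
      omega
    rw [sub_eq_zero] at ha hb hc
    rw [ha, hb, hc]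
  have hcount := aux_combi p m hm0 f M D P e k he hs h1 h2 hinj
  have hmin : ∀ v ∈ pCode p m f, v ≠ 0 → M - D ≤ (hammingNorm v : ℤ) := by
    rintro v ⟨a, b, c, rfl⟩ hv
    by_cases ha : a = 0
    · subst ha
      by_cases hb : b = 0
      · subst hb
        have hc0 : c ≠ 0 := by
          rintro rfl
          apply hv
          funext x; simp [pWord, tr]
        rw [hz, if_neg hc0]
        omega
      · rw [h2 b hb]; omega
    · rw [h1 a ha]
      rcases he a ha with h5 | h5 <;> rw [h5] <;> split_ifs <;> omega
  have hpos : 0 < (p ^ m - 1) * p ^ m := by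
    have : 1 < p ^ m := Nat.one_lt_pow hm0.ne' (by omega)
    exact Nat.mul_pos (by omega) (by omega)
  have hB : 2 * pAw p m f (M - D) = (p ^ m - 1) * p ^ m := by
    rw [hcount]
    rw [if_neg (by omega), if_neg (by omega), if_neg (by omega), if_pos (by omega), if_neg (by omega),
      if_neg (by omega), if_neg (by omega)]
    ring
  refine ⟨?_, hmin, ?_, ?_, ?_, ?_, hB, ?_, ?_, ?_, ?_⟩
  · have : pCode p m f = Set.range
        (fun t : GaloisField p m × GaloisField p m × ZMod p => pWord p m f t.1 t.2.1 t.2.2) := by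
      ext v
      constructor
      · rintro ⟨a, b, c, rfl⟩; exact ⟨(a, b, c), rfl⟩
      · rintro ⟨⟨a, b, c⟩, rfl⟩; exact ⟨a, b, c, rfl⟩
    rw [this, Set.ncard_range_of_injective hinj, Nat.card_eq_fintype_card, Fintype.card_prod,
      Fintype.card_prod, hc, ZMod.card]
    ring
  · have h5 : pAw p m f (M - D) ≠ 0 := by
      intro h; rw [h] at hB; omega
    rw [pAw] at h5
    obtain ⟨⟨v, hv, hw⟩⟩ := (Nat.card_ne_zero.1 h5).1
    refine ⟨v, hv, ?_, hw⟩
    rintro rfl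
    simp at hw
    omega
  · have := hcount 0
    rw [if_pos (by omega), if_neg (by omega), if_neg (by omega), if_neg (by omega), if_neg (by omega),
      if_neg (by omega), if_neg (by omega)] at this
    omega
  · have := hcount M
    rw [if_neg (by omega), if_neg (by omega), if_pos (by omega), if_neg (by omega), if_neg (by omega),
      if_neg (by omega), if_neg (by omega)] at this
    simp only [mul_zero, mul_one, add_zero, zero_add] at this
    omega
  · rw [hcount]
    rw [if_neg (by omega), if_neg (by omega), if_neg (by omega), if_neg (by omega), if_pos (by omega),
      if_neg (by omega), if_neg (by omega)]
    ring
  · rw [hcount]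
    rw [if_neg (by omega), if_neg (by omega), if_neg (by omega), if_neg (by omega), if_neg (by omega),
      if_pos (by omega), if_neg (by omega)]
    ring
  · rw [hcount]
    rw [if_neg (by omega), if_neg (by omega), if_neg (by omega), if_neg (by omega), if_neg (by omega),
      if_neg (by omega), if_pos (by omega)]
    ring
  · have := hcount ((p : ℤ) ^ m)
    rw [if_neg (by omega), if_pos (by omega), if_neg (by omega), if_neg (by omega), if_neg (by omega),
      if_neg (by omega), if_neg (by omega)] at this
    simp only [mul_zero, mul_one, add_zero, zero_add] at this
    omega
  · intro w hw
    simp only [Set.mem_insert_iff, Set.mem_singleton_iff, not_or] at hw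
    obtain ⟨w1, w2, w3, w4, w5, w6, w7⟩ := hw
    have := hcount w
    rw [if_neg (by omega), if_neg (by omega), if_neg (by omega), if_neg (by omega), if_neg (by omega),
      if_neg (by omega), if_neg (by omega)] at this
    omega
end
end

section
/- Let m and k be positive integers with k odd and gcd(m,k) = 1, and let f(x) = x^{(3^k+1)/2} on F_{3^m}. For u ∈ F_{3^m}, let N_u be the number of triples (x,y,z) ∈ F_{3^m}^3 satisfying x + y + z = 0 and f(x) + f(y) + f(z) + u = 0. Then N_0 = 3^m; N_u = 2·3^m if u is a nonzero square in F_{3^m}; and N_u = 0 if u is a nonsquare in F_{3^m}. -/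
noncomputable section
open scoped Classical

instance : Fact (Nat.Prime 3) := ⟨Nat.prime_three⟩

/-- The Coulter–Matthews function `f(x) = x^{(3^k+1)/2}` on `F_{3^m}`. -/
def cmf (m k : ℕ) (x : GaloisField 3 m) : GaloisField 3 m :=
  x ^ ((3 ^ k + 1) / 2)

/-- `N_u`: the number of triples `(x,y,z) ∈ F_{3^m}^3` with `x + y + z = 0` and
`f(x) + f(y) + f(z) + u = 0`. -/
def Ncm (m k : ℕ) (u : GaloisField 3 m) : ℕ :=
  Nat.card {t : GaloisField 3 m × GaloisField 3 m × GaloisField 3 m //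
    t.1 + t.2.1 + t.2.2 = 0 ∧ cmf m k t.1 + cmf m k t.2.1 + cmf m k t.2.2 + u = 0}

lemma cm_scal {K : Type*} [Field K] (i x y a b : K) (hi : i ^ 4 = 1)
    (h1 : a ^ 2 = i ^ 2 * x ^ 2) (h2 : a * b = i ^ 2 * (x * y)) (h3 : b ^ 2 = i ^ 2 * y ^ 2) :
    ∃ c : K, c ^ 4 = 1 ∧ a = c * x ∧ b = c * y := by
  have hi0 : i ≠ 0 := by rintro rfl; simp at hi
  have ha : a = i * x ∨ a = -(i * x) := by
    apply sq_eq_sq_iff_eq_or_eq_neg.mp; rw [h1]; ring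
  have hb : b = i * y ∨ b = -(i * y) := by
    apply sq_eq_sq_iff_eq_or_eq_neg.mp; rw [h3]; ring
  have hni : (-i) ^ 4 = 1 := by rw [← hi]; ring
  by_cases hx : x = 0
  · subst hx
    have ha0 : a = 0 := by simpa using h1
    rcases hb with hb | hb
    · exact ⟨i, hi, by simp [ha0], hb⟩
    · exact ⟨-i, hni, by simp [ha0], by rw [hb]; ring⟩
  · rcases ha with ha | ha
    · refine ⟨i, hi, ha, ?_⟩
      rw [ha] at h2
      apply mul_left_cancel₀ (mul_ne_zero hi0 hx)
      rw [h2]; ring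
    · refine ⟨-i, hni, by rw [ha]; ring, ?_⟩
      rw [ha] at h2
      apply mul_left_cancel₀ (mul_ne_zero hi0 hx)
      linear_combination -h2

lemma cm_det {K : Type*} [Field K] [CharP K 3] [IsAlgClosed K] (k : ℕ) (h4 : 4 ∣ 3 ^ k + 1)
    (e x y a b : K) (he : e ^ 2 = 1)
    (h1 : -a ^ 2 + a * b + b ^ 2 = e * (-x ^ 2 + x * y + y ^ 2))
    (h2 : -a ^ 2 - a * b + b ^ 2 = e * (-x ^ 2 - x * y + y ^ 2))
    (h3 : -a ^ 2 - b ^ 2 = e * (-x ^ 2 - y ^ 2)) :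
    a * b ^ 3 ^ k - a ^ 3 ^ k * b = x * y ^ 3 ^ k - x ^ 3 ^ k * y := by
  have t3 : (3 : K) = 0 := by exact_mod_cast CharP.cast_eq_zero K 3
  obtain ⟨i, hi⟩ := IsAlgClosed.exists_pow_nat_eq e (n := 2) (by norm_num)
  obtain ⟨c, hc, rfl, rfl⟩ := cm_scal i x y a b (by rw [← he, ← hi]; ring)
    (by rw [hi]; linear_combination -h1 - h2 + h3 + (b ^ 2 - e * y ^ 2) * t3)
    (by rw [hi]; linear_combination h2 - h1 + (a * b - e * (x * y)) * t3)
    (by rw [hi]; linear_combination h1 + h2 + h3 + (a ^ 2 - e * x ^ 2) * t3)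
  obtain ⟨n, hn⟩ := h4
  have : c * c ^ 3 ^ k = 1 := by
    rw [← pow_succ', hn, pow_mul, hc, one_pow]
  rw [mul_pow, mul_pow]
  linear_combination (x * y ^ 3 ^ k - x ^ 3 ^ k * y) * this

lemma cm_core {K : Type*} [Field K] [CharP K 3] [IsAlgClosed K] (m k d : ℕ)
    (h4 : 4 ∣ 3 ^ k + 1) (hd : 2 * d = 3 ^ k + 1) (t : K) (ht : t ^ 3 ^ m = t) :
    ∃ h : K, h ^ 2 = -(t ^ d + (t + 1) ^ d + (t - 1) ^ d) ∧ h ^ 3 ^ m = h ∧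
      (h = 0 → t ^ 3 ^ k = t) := by
  have t3 : (3 : K) = 0 := by exact_mod_cast CharP.cast_eq_zero K 3
  have : Fact (Nat.Prime 3) := ⟨Nat.prime_three⟩
  have : ExpChar K 3 := ExpChar.prime Nat.prime_three
  obtain ⟨s, hs⟩ := IsAlgClosed.exists_pow_nat_eq t (n := 2) (by norm_num)
  obtain ⟨p, hp⟩ := IsAlgClosed.exists_pow_nat_eq (t + 1) (n := 2) (by norm_num)
  obtain ⟨q, hq⟩ := IsAlgClosed.exists_pow_nat_eq (t - 1) (n := 2) (by norm_num)
  have hσ : s + p + q ≠ 0 := by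
    intro h0
    have hq' : q = -(s + p) := by linear_combination h0
    have : (p - s) ^ 2 = 0 := by
      rw [hq'] at hq
      linear_combination 2 * hs + 2 * hp - hq + (t + 1) * t3
    have hps : p = s := by
      have := pow_eq_zero_iff (two_ne_zero) |>.mp this
      linear_combination this
    rw [hps] at hp
    have : (1 : K) = 0 := by linear_combination hs - hp
    exact one_ne_zero this
  obtain ⟨b, hb⟩ := IsAlgClosed.exists_pow_nat_eq (s + p + q) (n := 2) (by norm_num)
  have hb0 : b ≠ 0 := by rintro rfl; apply hσ; rw [← hb]; ring
  obtain ⟨a, hab⟩ : ∃ a, a * b = p - s := ⟨(p - s) / b, by field_simp⟩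
  have ha2 : a ^ 2 = - q - b ^ 2 := by
    apply mul_right_cancel₀ (pow_ne_zero 2 hb0)
    have e1 : a ^ 2 * b ^ 2 = (p - s) ^ 2 := by rw [← hab]; ring
    rw [e1, hb]
    linear_combination 2 * hs + 2 * hp + 2 * hq + (2 * t + q * (s + p)) * t3
  have hs' : s = -a ^ 2 + a * b + b ^ 2 := by
    rw [ha2, hab, hb]; linear_combination (- p - q) * t3
  have hp' : p = -a ^ 2 - a * b + b ^ 2 := by
    rw [ha2, hab, hb]; linear_combination (- s - q) * t3
  have hq' : q = -a ^ 2 - b ^ 2 := by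
    rw [ha2]; ring
  have frob : ∀ (n : ℕ) (x y : K), (x + y) ^ 3 ^ n = x ^ 3 ^ n + y ^ 3 ^ n :=
    fun n x y => add_pow_char_pow x y 3 n
  have frobs : ∀ (n : ℕ) (x y : K), (x - y) ^ 3 ^ n = x ^ 3 ^ n - y ^ 3 ^ n :=
    fun n x y => sub_pow_char_pow x y n
  have frobn : ∀ (n : ℕ) (x : K), (-x) ^ 3 ^ n = -x ^ 3 ^ n := by
    intro n x
    have := frobs n 0 x
    simpa using this
  have Fs : ∀ n, s ^ 3 ^ n = -(a ^ 3 ^ n) ^ 2 + a ^ 3 ^ n * b ^ 3 ^ n + (b ^ 3 ^ n) ^ 2 := by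
    intro n; rw [hs', frob, frob, frobn, mul_pow, pow_right_comm a, pow_right_comm b]
  have Fp : ∀ n, p ^ 3 ^ n = -(a ^ 3 ^ n) ^ 2 - a ^ 3 ^ n * b ^ 3 ^ n + (b ^ 3 ^ n) ^ 2 := by
    intro n; rw [hp', frob, frobs, frobn, mul_pow, pow_right_comm a, pow_right_comm b]
  have Fq : ∀ n, q ^ 3 ^ n = -(a ^ 3 ^ n) ^ 2 - (b ^ 3 ^ n) ^ 2 := by
    intro n; rw [hq', frobs, frobn, pow_right_comm a, pow_right_comm b]
  have key : ∀ r w : K, r ^ 2 = w → w ^ d = r * r ^ 3 ^ k := by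
    intro r w hr; rw [← hr, ← pow_mul, hd, pow_succ']
  refine ⟨a * b ^ 3 ^ k - a ^ 3 ^ k * b, ?_, ?_, ?_⟩
  · rw [key s t hs, key p _ hp, key q _ hq, Fs, Fp, Fq]
    generalize a ^ 3 ^ k = A
    generalize b ^ 3 ^ k = B
    rw [hs', hp', hq']
    linear_combination (a ^ 2 * A ^ 2 + b ^ 2 * B ^ 2) * t3
  · have sg : ∀ r w : K, r ^ 2 = w → w ^ 3 ^ m = w → r ^ 3 ^ m = r ∨ r ^ 3 ^ m = -r := by
      intro r w hr hw
      apply sq_eq_sq_iff_eq_or_eq_neg.mp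
      rw [← pow_right_comm, hr, hw]
    have ss := sg s t hs ht
    have sp := sg p _ hp (by rw [frob, ht, one_pow])
    have sq := sg q _ hq (by rw [frobs, ht, one_pow])
    rw [Fs] at ss
    rw [Fp] at sp
    rw [Fq] at sq
    have e0 : (a * b ^ 3 ^ k - a ^ 3 ^ k * b) ^ 3 ^ m =
        a ^ 3 ^ m * (b ^ 3 ^ m) ^ 3 ^ k - (a ^ 3 ^ m) ^ 3 ^ k * b ^ 3 ^ m := by
      rw [frobs, mul_pow, mul_pow, pow_right_comm b, pow_right_comm a]
    rw [e0]
    generalize a ^ 3 ^ m = a' at *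
    generalize b ^ 3 ^ m = b' at *
    have D := cm_det (K := K) k h4
    -- the four sign patterns up to global sign
    have c0 : ∀ e : K, e ^ 2 = 1 → -a' ^ 2 + a' * b' + b' ^ 2 = e * s →
        -a' ^ 2 - a' * b' + b' ^ 2 = e * p → -a' ^ 2 - b' ^ 2 = e * q →
        a' * b' ^ 3 ^ k - a' ^ 3 ^ k * b' = a * b ^ 3 ^ k - a ^ 3 ^ k * b := by
      intro e he u v w
      exact D e a b a' b' he (by rw [u, hs']) (by rw [v, hp']) (by rw [w, hq'])
    have c1 : ∀ e : K, e ^ 2 = 1 → -a' ^ 2 + a' * b' + b' ^ 2 = e * -s →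
        -a' ^ 2 - a' * b' + b' ^ 2 = e * -p → -a' ^ 2 - b' ^ 2 = e * q →
        a' * b' ^ 3 ^ k - a' ^ 3 ^ k * b' = a * b ^ 3 ^ k - a ^ 3 ^ k * b := by
      intro e he u v w
      rw [D e b (-a) a' b' he (by rw [u, hs']; ring) (by rw [v, hp']; ring)
        (by rw [w, hq']; ring), frobn]
      ring
    have c2 : ∀ e : K, e ^ 2 = 1 → -a' ^ 2 + a' * b' + b' ^ 2 = e * -s →
        -a' ^ 2 - a' * b' + b' ^ 2 = e * p → -a' ^ 2 - b' ^ 2 = e * -q →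
        a' * b' ^ 3 ^ k - a' ^ 3 ^ k * b' = a * b ^ 3 ^ k - a ^ 3 ^ k * b := by
      intro e he u v w
      rw [D e (a + b) (a - b) a' b' he (by rw [u, hs']; linear_combination (e * a * b) * t3)
        (by rw [v, hp']; linear_combination (e * a * b) * t3)
        (by rw [w, hq']; linear_combination (e * (a ^ 2 + b ^ 2)) * t3), frobs, frob]
      linear_combination (-a * b ^ 3 ^ k + b * a ^ 3 ^ k) * t3
    have c3 : ∀ e : K, e ^ 2 = 1 → -a' ^ 2 + a' * b' + b' ^ 2 = e * s →
        -a' ^ 2 - a' * b' + b' ^ 2 = e * -p → -a' ^ 2 - b' ^ 2 = e * -q →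
        a' * b' ^ 3 ^ k - a' ^ 3 ^ k * b' = a * b ^ 3 ^ k - a ^ 3 ^ k * b := by
      intro e he u v w
      rw [D e (a - b) (-(a + b)) a' b' he (by rw [u, hs']; linear_combination (-e * a * b) * t3)
        (by rw [v, hp']; linear_combination (-e * a * b) * t3)
        (by rw [w, hq']; linear_combination (e * (a ^ 2 + b ^ 2)) * t3), frobn, frobs, frob]
      linear_combination (-a * b ^ 3 ^ k + b * a ^ 3 ^ k) * t3
    have o : (1 : K) ^ 2 = 1 := by norm_num
    have o' : (-1 : K) ^ 2 = 1 := by norm_num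
    rcases ss with u | u <;> rcases sp with v | v <;> rcases sq with w | w
    · exact c0 1 o (by simpa using u) (by simpa using v) (by simpa using w)
    · exact c1 (-1) o' (by simpa using u) (by simpa using v) (by simpa using w)
    · exact c2 (-1) o' (by simpa using u) (by simpa using v) (by simpa using w)
    · exact c3 1 o (by simpa using u) (by simpa using v) (by simpa using w)
    · exact c3 (-1) o' (by simpa using u) (by simpa using v) (by simpa using w)
    · exact c2 1 o (by simpa using u) (by simpa using v) (by simpa using w)
    · exact c1 1 o (by simpa using u) (by simpa using v) (by simpa using w)
    · exact c0 (-1) o' (by simpa using u) (by simpa using v) (by simpa using w)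
  · intro h0
    obtain ⟨μ, hμ⟩ : ∃ μ, b ^ 3 ^ k = μ * b := ⟨b ^ 3 ^ k / b, by field_simp⟩
    have hμa : a ^ 3 ^ k = μ * a := by
      apply mul_right_cancel₀ hb0
      rw [hμ] at h0
      linear_combination -h0
    have es : s ^ 3 ^ k = μ ^ 2 * s := by rw [Fs, hμ, hμa, hs']; ring
    have ep : p ^ 3 ^ k = μ ^ 2 * p := by rw [Fp, hμ, hμa, hp']; ring
    have et : t ^ 3 ^ k = μ ^ 4 * t := by rw [← hs, pow_right_comm, es]; ring
    have et1 : (t + 1) ^ 3 ^ k = μ ^ 4 * (t + 1) := by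
      rw [← hp, pow_right_comm, ep]; ring
    rw [frob, one_pow, et] at et1
    have : μ ^ 4 = 1 := by linear_combination -et1
    rw [et, this, one_mul]

lemma cm_gcd (m k d : ℕ) (hmk : Nat.gcd m k = 1)
    (hd : 2 * d = 3 ^ k + 1) (hd4 : d % 4 = 2) : Nat.gcd d (3 ^ m - 1) = 2 := by
  have h1 : d ∣ 3 ^ (2 * k) - 1 := by
    have : 3 ^ (2 * k) - 1 = (3 ^ k + 1) * (3 ^ k - 1) := by
      rw [mul_comm 2 k, pow_mul]
      have := Nat.sq_sub_sq (3 ^ k) 1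
      simpa using this
    rw [this, ← hd]
    exact Dvd.dvd.mul_right (Dvd.intro_left 2 rfl) _
  have h2 : Nat.gcd d (3 ^ m - 1) ∣ 3 ^ (Nat.gcd (2 * k) m) - 1 := by
    rw [← Nat.pow_sub_one_gcd_pow_sub_one]
    exact Nat.gcd_dvd_gcd_of_dvd_left _ h1
  have h3 : Nat.gcd (2 * k) m ∣ 2 := by
    have : Nat.Coprime k m := by rw [Nat.Coprime, Nat.gcd_comm]; exact hmk
    rw [Nat.Coprime.gcd_mul_right_cancel 2 this]
    exact Nat.gcd_dvd_left _ _
  have h4 : Nat.gcd d (3 ^ m - 1) ∣ 8 := h2.trans (by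
    have := Nat.pow_sub_one_dvd_pow_sub_one 3 h3
    simpa using this)
  have h5 : 2 ∣ Nat.gcd d (3 ^ m - 1) := by
    apply Nat.dvd_gcd
    · omega
    · have : Odd (3 ^ m) := Odd.pow (by decide)
      obtain ⟨r, hr⟩ := this
      omega
  have h6 : ¬ 4 ∣ Nat.gcd d (3 ^ m - 1) := by
    intro h
    have := h.trans (Nat.gcd_dvd_left _ _)
    omega
  have h7 := Nat.le_of_dvd (by norm_num) h4
  generalize Nat.gcd d (3 ^ m - 1) = g at *
  interval_cases g <;> omega

lemma cm_d (k : ℕ) (hk : Odd k) : 8 ∣ 3 ^ k + 5 := by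
  obtain ⟨n, rfl⟩ := hk
  induction n with
  | zero => norm_num
  | succ n ih =>
    rw [show 2 * (n + 1) + 1 = 2 * n + 1 + 2 by ring, pow_add _ _ 2]
    generalize 3 ^ (2 * n + 1) = x at *
    omega

lemma cm_sq {F : Type*} [Field F] [Fintype F] [CharP F 3] (m k d : ℕ)
    (hF : Fintype.card F = 3 ^ m) (hmk : Nat.gcd m k = 1)
    (h4 : 4 ∣ 3 ^ k + 1) (hd : 2 * d = 3 ^ k + 1) (t : F) :
    t ^ d + (t + 1) ^ d + (t - 1) ^ d ≠ 0 ∧ IsSquare (-(t ^ d + (t + 1) ^ d + (t - 1) ^ d)) := by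
  have t3 : (3 : F) = 0 := by exact_mod_cast CharP.cast_eq_zero F 3
  have : Fact (Nat.Prime 3) := ⟨Nat.prime_three⟩
  have : ExpChar F 3 := ExpChar.prime Nat.prime_three
  have hpow : ∀ x : F, x ^ 3 ^ m = x := by
    intro x; rw [← hF]; exact FiniteField.pow_card x
  have : CharP (AlgebraicClosure F) 3 := charP_of_injective_algebraMap
    (algebraMap F (AlgebraicClosure F)).injective 3
  obtain ⟨h, h1, h2, h3⟩ := cm_core m k d h4 hd (algebraMap F (AlgebraicClosure F) t)
    (by rw [← map_pow, hpow])
  have h1' : h ^ 2 = algebraMap F (AlgebraicClosure F)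
      (-(t ^ d + (t + 1) ^ d + (t - 1) ^ d)) := by
    rw [h1]; simp
  have hd0 : d ≠ 0 := by have : 0 < 3 ^ k := by positivity
                         omega
  have hde : Even d := by
    rw [← hd] at h4
    exact even_iff_two_dvd.mpr (by omega)
  have hne : t ^ d + (t + 1) ^ d + (t - 1) ^ d ≠ 0 := by
    intro h0
    rw [h0] at h1'
    have hh : h = 0 := by simpa using h1'
    have htk : t ^ 3 ^ k = t := by
      apply (algebraMap F (AlgebraicClosure F)).injective
      rw [map_pow]; exact h3 hh
    have p1 : Function.IsPeriodicPt (frobenius F 3) k t := by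
      rw [Function.IsPeriodicPt, Function.IsFixedPt, iterate_frobenius]; exact htk
    have p2 : Function.IsPeriodicPt (frobenius F 3) m t := by
      rw [Function.IsPeriodicPt, Function.IsFixedPt, iterate_frobenius]; exact hpow t
    have p3 := p2.gcd p1
    rw [hmk, Function.IsPeriodicPt, Function.IsFixedPt, iterate_frobenius] at p3
    have p4 : t * ((t + 1) * (t - 1)) = 0 := by
      rw [pow_one] at p3; linear_combination p3
    rcases mul_eq_zero.mp p4 with e | e
    · subst e
      rw [zero_pow hd0, zero_add, zero_add, zero_sub, one_pow, hde.neg_one_pow] at h0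
      exact one_ne_zero (α := F) (by linear_combination t3 - h0)
    rcases mul_eq_zero.mp e with e | e
    · obtain rfl : t = -1 := by linear_combination e
      rw [show (-1 : F) - 1 = 1 by linear_combination -t3, neg_add_cancel, zero_pow hd0, one_pow,
        hde.neg_one_pow] at h0
      exact one_ne_zero (α := F) (by linear_combination t3 - h0)
    · obtain rfl : t = 1 := by linear_combination e
      rw [show (1 : F) + 1 = -1 by linear_combination t3, sub_self, zero_pow hd0, one_pow,
        hde.neg_one_pow] at h0
      exact one_ne_zero (α := F) (by linear_combination t3 - h0)
  refine ⟨hne, ?_⟩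
  have h0 : h ≠ 0 := by
    rintro rfl
    apply hne
    have : (algebraMap F (AlgebraicClosure F)) (-(t ^ d + (t + 1) ^ d + (t - 1) ^ d)) = 0 := by
      rw [← h1']; simp
    have := (map_eq_zero _).mp this
    exact neg_eq_zero.mp this
  rw [FiniteField.isSquare_iff (by rw [ringChar.eq F 3]; norm_num) (neg_ne_zero.mpr hne)]
  apply (algebraMap F (AlgebraicClosure F)).injective
  rw [map_pow, ← h1', ← pow_mul, map_one, hF]
  apply mul_right_cancel₀ h0
  have : 2 * (3 ^ m / 2) + 1 = 3 ^ m := by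
    have : Odd (3 ^ m) := Odd.pow (by decide)
    obtain ⟨r, hr⟩ := this
    omega
  rw [← pow_succ, this, h2, one_mul]

lemma cm_pow {F : Type*} [Field F] [Fintype F] (m d : ℕ) (hd0 : d ≠ 0)
    (hF : Fintype.card F = 3 ^ m) (hg : Nat.gcd d (3 ^ m - 1) = 2) (w : F) (hw : w ≠ 0)
    (hs : IsSquare w) : ∃ b : F, b ≠ 0 ∧ ∀ c, c ^ d = w ↔ c = b ∨ c = -b := by
  have hp1 : ∀ x : F, x ≠ 0 → x ^ (3 ^ m - 1) = 1 := by
    intro x hx; rw [← hF]; exact FiniteField.pow_card_sub_one_eq_one x hx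
  have hd : 2 ∣ d := by rw [← hg]; exact Nat.gcd_dvd_left _ _
  obtain ⟨r, rfl⟩ := hs
  have hr : r ≠ 0 := by rintro rfl; simp at hw
  have hb : (r ^ (Nat.gcdA d (3 ^ m - 1))) ^ d = r * r := by
    have := Nat.gcd_eq_gcd_ab d (3 ^ m - 1)
    rw [hg] at this
    rw [← zpow_natCast, ← zpow_mul, mul_comm]
    have e : r * r = r ^ ((2 : ℕ) : ℤ) := by rw [zpow_natCast]; ring
    rw [e, this, zpow_add₀ hr, zpow_mul r (((3 ^ m - 1 : ℕ)) : ℤ), zpow_natCast r (3 ^ m - 1),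
      hp1 r hr, one_zpow, mul_one]
  refine ⟨r ^ (Nat.gcdA d (3 ^ m - 1)), zpow_ne_zero _ hr, fun c => ?_⟩
  have hb0 : r ^ (Nat.gcdA d (3 ^ m - 1)) ≠ 0 := zpow_ne_zero _ hr
  generalize r ^ (Nat.gcdA d (3 ^ m - 1)) = b at *
  constructor
  · intro hc
    have hc0 : c ≠ 0 := by
      rintro rfl; rw [zero_pow hd0] at hc; exact hw hc.symm
    have h1 : (c / b) ^ d = 1 := by rw [div_pow, hc, hb, div_self hw]
    have h2 := pow_gcd_eq_one.mpr ⟨h1, hp1 _ (div_ne_zero hc0 hb0)⟩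
    rw [hg] at h2
    rcases (sq_eq_sq_iff_eq_or_eq_neg.mp (h2.trans (one_pow 2).symm)) with h | h
    · left; field_simp at h; exact h
    · right; field_simp at h; exact h
  · have : Even d := even_iff_two_dvd.mpr hd
    rintro (rfl | rfl)
    · exact hb
    · rw [this.neg_pow]; exact hb

lemma cm_count {F : Type*} [Field F] (m d : ℕ) (hcard : Nat.card F = 3 ^ m) (t3 : (3 : F) = 0)
    (hd0 : d ≠ 0) (hde : 2 ∣ d)
    (hsq : ∀ t : F, t ^ d + (t + 1) ^ d + (t - 1) ^ d ≠ 0 ∧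
      IsSquare (-(t ^ d + (t + 1) ^ d + (t - 1) ^ d)))
    (hpw : ∀ w : F, w ≠ 0 → IsSquare w → ∃ b : F, b ≠ 0 ∧ ∀ c, c ^ d = w ↔ c = b ∨ c = -b) :
    Nat.card {t : F × F × F // t.1 + t.2.1 + t.2.2 = 0 ∧
      t.1 ^ d + t.2.1 ^ d + t.2.2 ^ d + 0 = 0} = 3 ^ m ∧
    (∀ u : F, u ≠ 0 → IsSquare u → Nat.card {t : F × F × F // t.1 + t.2.1 + t.2.2 = 0 ∧
      t.1 ^ d + t.2.1 ^ d + t.2.2 ^ d + u = 0} = 2 * 3 ^ m) ∧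
    (∀ u : F, ¬ IsSquare u → Nat.card {t : F × F × F // t.1 + t.2.1 + t.2.2 = 0 ∧
      t.1 ^ d + t.2.1 ^ d + t.2.2 ^ d + u = 0} = 0) := by
  -- every solution is a scaled translate
  have param : ∀ x y z : F, x + y + z = 0 → x ≠ y →
      x = (y - x) * (x / (y - x)) ∧ y = (y - x) * (x / (y - x) + 1) ∧
      z = (y - x) * (x / (y - x) - 1) := by
    intro x y z h hxy
    have h1 : y - x ≠ 0 := sub_ne_zero.mpr (Ne.symm hxy)
    refine ⟨by field_simp, by field_simp; ring, ?_⟩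
    field_simp
    linear_combination h - x * t3
  have scale : ∀ b t : F, (b * t) ^ d + (b * (t + 1)) ^ d + (b * (t - 1)) ^ d =
      b ^ d * (t ^ d + (t + 1) ^ d + (t - 1) ^ d) := by
    intro b t; rw [mul_pow, mul_pow, mul_pow]; ring
  have diag : ∀ x y z : F, x + y + z = 0 → x = y → z = x := by
    rintro x y z h rfl
    linear_combination h - x * t3
  refine ⟨?_, ?_, ?_⟩
  · rw [← hcard]
    symm
    refine Nat.card_eq_of_bijective (fun x : F => ⟨(x, x, x), ?_, ?_⟩) ⟨?_, ?_⟩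
    · show x + x + x = 0
      linear_combination x * t3
    · show x ^ d + x ^ d + x ^ d + 0 = 0
      linear_combination x ^ d * t3
    · intro x y h
      simpa using h
    · rintro ⟨⟨x, y, z⟩, h1, h2⟩
      dsimp only at h1 h2
      have hxy : x = y := by
        by_contra hne
        obtain ⟨e1, e2, e3⟩ := param x y z h1 hne
        have h3 : (y - x) ^ d * ((x / (y - x)) ^ d + (x / (y - x) + 1) ^ d +
            (x / (y - x) - 1) ^ d) = 0 := by
          rw [← scale, ← e1, ← e2, ← e3]; linear_combination h2
        rcases mul_eq_zero.mp h3 with h | h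
        · exact hne (sub_eq_zero.mp (pow_eq_zero_iff hd0 |>.mp h)).symm
        · exact (hsq _).1 h
      have hz := diag x y z h1 hxy
      refine ⟨x, ?_⟩
      simp [← hxy, hz]
  · intro u hu hus
    have hb : ∀ t : F, ∃ b : F, b ≠ 0 ∧ ∀ c, c ^ d * (t ^ d + (t + 1) ^ d + (t - 1) ^ d) + u = 0 ↔
        c = b ∨ c = -b := by
      intro t
      obtain ⟨hn, hs⟩ := hsq t
      obtain ⟨b, hb0, hb⟩ := hpw (u / -(t ^ d + (t + 1) ^ d + (t - 1) ^ d))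
        (div_ne_zero hu (neg_ne_zero.mpr hn)) (hus.div hs)
      refine ⟨b, hb0, fun c => ?_⟩
      rw [← hb c, eq_div_iff (neg_ne_zero.mpr hn)]
      constructor <;> intro h <;> linear_combination -h
    choose B hB0 hB using hb
    have hcc : Nat.card (Bool × F) = 2 * 3 ^ m := by
      rw [Nat.card_prod, hcard]; simp
    rw [← hcc]
    symm
    have sgn : ∀ (e : Bool) (t : F), (if e then B t else -B t) ^ d *
        (t ^ d + (t + 1) ^ d + (t - 1) ^ d) + u = 0 := by
      intro e t
      rw [hB]
      cases e <;> simp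
    refine Nat.card_eq_of_bijective (fun w : Bool × F =>
      ⟨((if w.1 then B w.2 else -B w.2) * w.2, (if w.1 then B w.2 else -B w.2) * (w.2 + 1),
        (if w.1 then B w.2 else -B w.2) * (w.2 - 1)), ?_, ?_⟩) ⟨?_, ?_⟩
    · show (if w.1 then B w.2 else -B w.2) * w.2 + (if w.1 then B w.2 else -B w.2) * (w.2 + 1)
        + (if w.1 then B w.2 else -B w.2) * (w.2 - 1) = 0
      generalize (if w.1 then B w.2 else -B w.2) = c
      linear_combination c * w.2 * t3
    · dsimp only
      rw [scale]; exact sgn _ _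
    · rintro ⟨e, t⟩ ⟨e', t'⟩ h
      simp only [Subtype.mk.injEq, Prod.mk.injEq] at h
      obtain ⟨g1, g2, -⟩ := h
      have hc : (if e then B t else -B t) = (if e' then B t' else -B t') := by
        linear_combination g2 - g1
      have hc0 : (if e' then B t' else -B t') ≠ 0 := by
        cases e' <;> simp [hB0]
      rw [hc] at g1
      obtain rfl := mul_left_cancel₀ hc0 g1
      have hne : B t ≠ -B t := by
        intro h
        apply hB0 t
        linear_combination B t * t3 - h
      cases e <;> cases e'
      · rfl
      · exact absurd (by simpa using hc.symm) hne
      · exact absurd (by simpa using hc) hne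
      · rfl
    · rintro ⟨⟨x, y, z⟩, h1, h2⟩
      dsimp only at h1 h2
      have hxy : x ≠ y := by
        intro hxy
        have hz := diag x y z h1 hxy
        rw [← hxy, hz] at h2
        apply hu
        linear_combination h2 - x ^ d * t3
      obtain ⟨e1, e2, e3⟩ := param x y z h1 hxy
      have h3 : (y - x) ^ d * ((x / (y - x)) ^ d + (x / (y - x) + 1) ^ d +
          (x / (y - x) - 1) ^ d) + u = 0 := by
        rw [← scale, ← e1, ← e2, ← e3]; exact h2
      rcases (hB _ _).mp h3 with h | h
      · refine ⟨(true, x / (y - x)), ?_⟩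
        simp only [if_true, Subtype.mk.injEq, Prod.mk.injEq]
        rw [← h]
        exact ⟨e1.symm, e2.symm, e3.symm⟩
      · refine ⟨(false, x / (y - x)), ?_⟩
        simp only [Bool.false_eq_true, if_false, Subtype.mk.injEq, Prod.mk.injEq]
        rw [← h]
        exact ⟨e1.symm, e2.symm, e3.symm⟩
  · intro u hu
    have : IsEmpty {t : F × F × F // t.1 + t.2.1 + t.2.2 = 0 ∧
        t.1 ^ d + t.2.1 ^ d + t.2.2 ^ d + u = 0} := by
      constructor
      rintro ⟨⟨x, y, z⟩, h1, h2⟩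
      dsimp only at h1 h2
      apply hu
      by_cases hxy : x = y
      · have hz := diag x y z h1 hxy
        rw [← hxy, hz] at h2
        have : u = 0 := by linear_combination h2 - x ^ d * t3
        rw [this]; exact IsSquare.zero
      · obtain ⟨e1, e2, e3⟩ := param x y z h1 hxy
        have h3 : (y - x) ^ d * ((x / (y - x)) ^ d + (x / (y - x) + 1) ^ d +
            (x / (y - x) - 1) ^ d) + u = 0 := by
          rw [← scale, ← e1, ← e2, ← e3]; exact h2
        have h4 : u = (y - x) ^ d * -((x / (y - x)) ^ d + (x / (y - x) + 1) ^ d +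
            (x / (y - x) - 1) ^ d) := by linear_combination h3
        rw [h4]
        exact ((even_iff_two_dvd.mpr hde).isSquare_pow _).mul (hsq _).2
    exact Nat.card_of_isEmpty

/-- For `k` odd with `gcd(m,k) = 1` and `f(x) = x^{(3^k+1)/2}` on
`F_{3^m}`:  `N_0 = 3^m`;  `N_u = 2·3^m` if `u` is a nonzero square;  and `N_u = 0`
if `u` is a nonsquare. -/
theorem stmt_12 (m k : ℕ) (hm : 0 < m) (hk : Odd k) (hmk : Nat.gcd m k = 1) :
    Ncm m k 0 = 3 ^ m ∧
    (∀ u : GaloisField 3 m, u ≠ 0 → IsSquare u → Ncm m k u = 2 * 3 ^ m) ∧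
    (∀ u : GaloisField 3 m, ¬ IsSquare u → Ncm m k u = 0) := by
  have hcard : Nat.card (GaloisField 3 m) = 3 ^ m := GaloisField.card 3 m hm.ne'
  have : Finite (GaloisField 3 m) := Nat.finite_of_card_ne_zero (by rw [hcard]; positivity)
  have := Fintype.ofFinite (GaloisField 3 m)
  have hF : Fintype.card (GaloisField 3 m) = 3 ^ m := by
    rw [← Nat.card_eq_fintype_card, hcard]
  have t3 : (3 : GaloisField 3 m) = 0 := by exact_mod_cast CharP.cast_eq_zero (GaloisField 3 m) 3
  have h8 := cm_d k hk
  obtain ⟨d, hd⟩ : ∃ d, d = (3 ^ k + 1) / 2 := ⟨_, rfl⟩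
  have hd2 : 2 * d = 3 ^ k + 1 := by omega
  have hd4 : d % 4 = 2 := by omega
  have h4 : 4 ∣ 3 ^ k + 1 := by omega
  have hd0 : d ≠ 0 := by omega
  have hde : 2 ∣ d := by omega
  have hg := cm_gcd m k d hmk hd2 hd4
  have hsq := cm_sq (F := GaloisField 3 m) m k d hF hmk h4 hd2
  have hpw := cm_pow (F := GaloisField 3 m) m d hd0 hF hg
  have hf : ∀ x, cmf m k x = x ^ d := by intro x; rw [hd]; rfl
  simp only [Ncm, hf]
  exact cm_count m d hcard t3 hd0 hde hsq hpw
end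
end
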